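/- The MDP model E2 is absorbing with the initial state x0 = b_1 = 1/2 (i.e. E^π_{1/2}[τ] < ∞ for every strategy π, and in fact sup_{π∈Π} E^π_{1/2}[τ] < ∞), but it is not Λ-uniformly absorbing with the initial state x0: for every n ≥ 3, E^{ψ^n}_{1/2}[Σ_{t=n}^∞ 1{τ > t}] ≥ 1/2, so sup_{π∈Λ} E^π_{1/2}[Σ_{t=n}^∞ 1{τ > t}] does not converge to 0 as n → ∞. -/

import Mathlib

open MeasureTheory ProbabilityTheory Filter Topology
open scoped ENNReal

noncomputable section

/-! ### General MDP framework

The state space of an absorbing-type MDP model is `X = Y ⊕ Unit`, where `Sum.inr ()` plays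
the role of the isolated cemetery point `Δ` and `Y` is embedded via `Sum.inl`.

A history up to stage `n` is `h_n = (x_0, a_1, x_1, …, a_n, x_n)`, which we encode as the
list of pairs `(x_k, a_{k+1})`, `k < n`, together with the last state `x_n`. -/

/-- The space `H_n` of histories up to stage `n`. -/
abbrev Hist (X A : Type*) (n : ℕ) : Type _ := (Fin n → X × A) × X

/-- A strategy: for every `n`, a stochastic (Markov) kernel on `A` given `H_n`,
prescribing the law of the action `a_{n+1}` given the history `h_n`. -/
def Strategy (X A : Type*) [MeasurableSpace X] [MeasurableSpace A] : Type _ :=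
  {π : (n : ℕ) → Kernel (Hist X A n) A // ∀ n, IsMarkovKernel (π n)}

variable {X A Y : Type*} [MeasurableSpace X] [MeasurableSpace A] [MeasurableSpace Y]

/-- The finite-dimensional distributions of the strategic measure `P^π_{x0}`:
`histLaw p π x0 n` is the joint law of `(X_0, A_1, …, A_n, X_n)` under `P^π_{x0}`,
built by the Ionescu-Tulcea recursion. -/
def histLaw (p : Kernel (X × A) X) (π : Strategy X A) (x0 : X) :
    (n : ℕ) → Measure (Hist X A n)
  | 0 => Measure.dirac (fun i => i.elim0, x0)
  | n + 1 =>
      (histLaw p π x0 n).bind fun h =>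
        ((π.1 n) h).bind fun a =>
          (p (h.2, a)).map fun x' => (Fin.snoc h.1 (h.2, a), x')

/-- The law of the pair `(X_n, A_{n+1})` under the strategic measure `P^π_{x0}`. -/
def pairLaw (p : Kernel (X × A) X) (π : Strategy X A) (x0 : X) (n : ℕ) :
    Measure (X × A) :=
  (histLaw p π x0 n).bind fun h => ((π.1 n) h).map fun a => (h.2, a)

/-- The occupation measure `η^π_{x0}` on `Y × A`:
`η^π_{x0}(dx × da) = Σ_n P^π_{x0}(X_n ∈ dx ∩ Y, A_{n+1} ∈ da)`. -/
def occupation (p : Kernel ((Y ⊕ Unit) × A) (Y ⊕ Unit)) (π : Strategy (Y ⊕ Unit) A)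
    (x0 : Y ⊕ Unit) : Measure (Y × A) :=
  Measure.sum fun n => (pairLaw p π x0 n).comap fun ya : Y × A => (Sum.inl ya.1, ya.2)

/-- `P^π_{x0}(X_t ∈ Y)`.  Since the cemetery `Δ` is absorbing, this equals the tail
probability `P^π_{x0}(τ > t)` of the hitting time `τ` of `Δ`. -/
def survive (p : Kernel ((Y ⊕ Unit) × A) (Y ⊕ Unit)) (π : Strategy (Y ⊕ Unit) A)
    (x0 : Y ⊕ Unit) (t : ℕ) : ℝ≥0∞ :=
  pairLaw p π x0 t {z | ∃ y : Y, z.1 = Sum.inl y}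

/-- The model is absorbing with initial state `x0`:
`E^π_{x0}[τ] = Σ_t P^π_{x0}(τ > t) < ∞` for every strategy `π`. -/
def IsAbsorbing (p : Kernel ((Y ⊕ Unit) × A) (Y ⊕ Unit)) (x0 : Y ⊕ Unit) : Prop :=
  ∀ π : Strategy (Y ⊕ Unit) A, ∑' t : ℕ, survive p π x0 t < ⊤

/-- The model is `Λ`-uniformly absorbing with initial state `x0`:
`sup_{π ∈ Λ} E^π_{x0}[Σ_{t=n}^∞ 1{τ > t}] = sup_{π ∈ Λ} Σ_{t ≥ n} P^π_{x0}(τ > t) → 0`. -/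
def IsUnifAbsorbing (p : Kernel ((Y ⊕ Unit) × A) (Y ⊕ Unit))
    (Λ : Set (Strategy (Y ⊕ Unit) A)) (x0 : Y ⊕ Unit) : Prop :=
  Tendsto (fun n : ℕ => ⨆ π ∈ Λ, ∑' t : ℕ, survive p π x0 (n + t)) atTop (𝓝 0)

/-- The set `D^Λ_{x0} ⊆ M(Y × A)` of occupation measures of strategies in `Λ`. -/
def OccSet (p : Kernel ((Y ⊕ Unit) × A) (Y ⊕ Unit)) (Λ : Set (Strategy (Y ⊕ Unit) A))
    (x0 : Y ⊕ Unit) : Set (FiniteMeasure (Y × A)) :=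
  {η | ∃ π ∈ Λ, (η : Measure (Y × A)) = occupation p π x0}

/-- Condition (S): the action space is compact and `a ↦ ∫ g dp(·|x,a)` is continuous for
every bounded measurable `g` and every state `x`. -/
def ConditionS [TopologicalSpace A] (p : Kernel (X × A) X) : Prop :=
  CompactSpace A ∧
    ∀ g : X → ℝ, Measurable g → (∃ C, ∀ x, |g x| ≤ C) →
      ∀ x : X, Continuous fun a : A => ∫ y, g y ∂(p (x, a))

/-- Condition (W): the action space is compact and `(x,a) ↦ ∫ g dp(·|x,a)` is continuous for
every bounded continuous `g`. -/
def ConditionW [TopologicalSpace X] [TopologicalSpace A] (p : Kernel (X × A) X) : Prop :=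
  CompactSpace A ∧
    ∀ g : X → ℝ, Continuous g → (∃ C, ∀ x, |g x| ≤ C) →
      Continuous fun xa : X × A => ∫ y, g y ∂(p xa)

/-- The w-topology on `M(Ω)`: the coarsest topology making `η ↦ ∫ g dη` continuous for
every bounded continuous `g : Ω → ℝ`. -/
def wTop (Ω : Type*) [TopologicalSpace Ω] [MeasurableSpace Ω] :
    TopologicalSpace (FiniteMeasure Ω) :=
  ⨅ (g : Ω → ℝ) (_ : Continuous g) (_ : ∃ C, ∀ z, |g z| ≤ C),
    TopologicalSpace.induced (fun η : FiniteMeasure Ω => ∫ z, g z ∂(η : Measure Ω))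
      inferInstance

/-- The ws-topology on `M(Y × A)`: the coarsest topology making `η ↦ ∫ g dη` continuous for
every bounded Caratheodory function `g : Y × A → ℝ`. -/
def wsTop (Y A : Type*) [MeasurableSpace Y] [TopologicalSpace A] [MeasurableSpace A] :
    TopologicalSpace (FiniteMeasure (Y × A)) :=
  ⨅ (g : Y × A → ℝ) (_ : Measurable g) (_ : ∃ C, ∀ z, |g z| ≤ C)
    (_ : ∀ y : Y, Continuous fun a : A => g (y, a)),
    TopologicalSpace.induced (fun η : FiniteMeasure (Y × A) => ∫ z, g z ∂(η : Measure (Y × A)))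
      inferInstance

/-- The s-topology on `M(Y)`: the coarsest topology making `η ↦ ∫ f dη` continuous for
every bounded measurable `f : Y → ℝ`. -/
def sTop (Y : Type*) [MeasurableSpace Y] : TopologicalSpace (FiniteMeasure Y) :=
  ⨅ (f : Y → ℝ) (_ : Measurable f) (_ : ∃ C, ∀ z, |f z| ≤ C),
    TopologicalSpace.induced (fun η : FiniteMeasure Y => ∫ z, f z ∂(η : Measure Y))
      inferInstance



/-! ### The MDP model E2 (Example 2 of the paper):
`Y = {b_n : n ≥ 1} ∪ {1} ⊆ ℝ` with `b_n = Σ_{i=1}^n 2^{-i} = 1 - 2^{-n}` (relative Euclidean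
topology), `A = {1,2,3}` discrete (here `Fin 3`, with `0 ↔ 1`, `1 ↔ 2`, `2 ↔ 3`). -/

/-- `b n = 1 - 2^{-n}`; the points of `Y` are `b n` for `n ≥ 1`, together with `1`. -/
def b2 : ℕ → ℝ := fun n => 1 - (1/2) ^ n

/-- The set `Y = {b_n : n ≥ 1} ∪ {1} ⊆ ℝ`. -/
def SY2 : Set ℝ := {x : ℝ | ∃ k : ℕ, x = b2 (k + 1)} ∪ {1}

/-- The space `Y` of the model E2, with the relative Euclidean topology. -/
abbrev Y2 : Type := ↥SY2

/-- The point `b_{k+1} ∈ Y` (so `bY 0 = b_1 = 1/2`). -/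
def bY (k : ℕ) : Y2 := ⟨b2 (k + 1), Or.inl ⟨k, rfl⟩⟩

/-- The point `1 ∈ Y`. -/
def oneY : Y2 := ⟨1, Or.inr rfl⟩

/-- The action space `A = {1,2,3}` of the model E2 (as `Fin 3`: `0 ↔ 1`, `1 ↔ 2`, `2 ↔ 3`). -/
abbrev A2 : Type := Fin 3

/-- The state space `X = Y ∪ {Δ}` of the model E2. -/
abbrev X2 : Type := Y2 ⊕ Unit

/-- The initial state `x₀ = b_1 = 1/2`. -/
def x02 : X2 := Sum.inl (bY 0)

/-- `π` is the deterministic stationary strategy given by the map `ψ`: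
at every stage the action is `ψ(x)` where `x` is the current state. -/
def IsStationaryWith {X A : Type*} [MeasurableSpace X] [MeasurableSpace A]
    (π : Strategy X A) (ψ : X → A) : Prop :=
  ∀ n, ∀ h : Hist X A n, (π.1 n) h = Measure.dirac (ψ h.2)

open scoped Classical in
/-- The map of the deterministic stationary strategy `ψ^n` (paper indexing, `n ≥ 3`):
action `2` on `{b_1, …, b_n}`, action `1` on `{b_m : m ≥ n+1}`, action `3` on `{1, Δ}`. -/
def psiN (n : ℕ) : X2 → A2 := fun x =>
  match x with
  | Sum.inr _ => 2
  | Sum.inl y =>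
      if (y : ℝ) = 1 then 2 else if ∃ k, k < n ∧ (y : ℝ) = b2 (k + 1) then 1 else 0

/-- The map of the deterministic stationary strategy `ψ ≡ 3`. -/
def psiInf : X2 → A2 := fun _ => 2

/-- `Λ = {ψ^n : n ≥ 3} ∪ {ψ}`. -/
def Lambda2 : Set (Strategy X2 A2) :=
  {π | ∃ n, 3 ≤ n ∧ IsStationaryWith π (psiN n)} ∪ {π | IsStationaryWith π psiInf}

section E2Kernel

variable (p : Kernel (X2 × A2) X2)

/-- The transition kernel of the model E2 (the action `a = 1` at `b_1` leads to `Δ`;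
at `b_n`, `n ≥ 2`, it stays with probability `1 - 2^{2-n}` and moves to `Δ` with probability
`2^{2-n}`; `a = 2` moves to `b_{n+1}` or `Δ` with probability `1/2` each; `a = 3` moves to
`b_{n+1}` with probability `1/2` and to `1` or `Δ` with probability `1/4` each; `1` and `Δ`
lead to `Δ`).  In the indexing below, `bY k` is the paper's `b_{k+1}`, and for `n = k+1 ≥ 2`
one has `2^{2-n} = (1/2)^{k-1}`. -/
def IsE2Kernel : Prop :=
  (∀ a : A2, p ((Sum.inr () : X2), a) {(Sum.inr () : X2)} = 1) ∧
  (∀ a : A2, p (Sum.inl oneY, a) {(Sum.inr () : X2)} = 1) ∧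
  (p (Sum.inl (bY 0), (0 : A2)) {(Sum.inr () : X2)} = 1) ∧
  (∀ k : ℕ, 1 ≤ k →
    p (Sum.inl (bY k), (0 : A2)) {(Sum.inl (bY k) : X2)} = 1 - (1/2 : ℝ≥0∞) ^ (k - 1) ∧
    p (Sum.inl (bY k), (0 : A2)) {(Sum.inr () : X2)} = (1/2 : ℝ≥0∞) ^ (k - 1)) ∧
  (∀ k : ℕ,
    p (Sum.inl (bY k), (1 : A2)) {(Sum.inr () : X2)} = 1/2 ∧
    p (Sum.inl (bY k), (1 : A2)) {(Sum.inl (bY (k + 1)) : X2)} = 1/2) ∧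
  (∀ k : ℕ,
    p (Sum.inl (bY k), (2 : A2)) {(Sum.inr () : X2)} = 1/4 ∧
    p (Sum.inl (bY k), (2 : A2)) {(Sum.inl oneY : X2)} = 1/4 ∧
    p (Sum.inl (bY k), (2 : A2)) {(Sum.inl (bY (k + 1)) : X2)} = 1/2)

end E2Kernel

instance [MeasurableSingletonClass X] [MeasurableSingletonClass Y] :
    MeasurableSingletonClass (X ⊕ Y) where
  measurableSet_singleton
    | Sum.inl x => by
      rw [← Set.image_singleton]
      exact (measurableSet_singleton x).inl_image
    | Sum.inr y => by
      rw [← Set.image_singleton]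
      exact measurableSet_inr_image.2 (measurableSet_singleton y)

instance : Countable Y2 := by
  have h : SY2.Countable := by
    refine Set.Countable.union ?_ (Set.countable_singleton 1)
    refine (Set.countable_range fun k : ℕ => b2 (k + 1)).mono ?_
    rintro x ⟨k, rfl⟩
    exact ⟨k, rfl⟩
  exact h.to_subtype

/-- The marginal law of the state at stage `n`, tested against a function. -/
lemma lintegral_histLaw_succ [Countable X] [MeasurableSingletonClass X] [Countable A]
    [MeasurableSingletonClass A] (p : Kernel (X × A) X) (π : Strategy X A) (x0 : X) (n : ℕ)
    (f : X → ℝ≥0∞) :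
    ∫⁻ h, f h.2 ∂(histLaw p π x0 (n + 1)) =
      ∫⁻ h, ∫⁻ a, ∫⁻ x, f x ∂(p (h.2, a)) ∂(π.1 n h) ∂(histLaw p π x0 n) := by
  rw [histLaw, Measure.lintegral_bind (measurable_of_countable _).aemeasurable
    (measurable_of_countable _).aemeasurable]
  congr with h
  rw [Measure.lintegral_bind (measurable_of_countable _).aemeasurable
    (measurable_of_countable _).aemeasurable]
  congr with a
  rw [lintegral_map (measurable_of_countable _) (measurable_of_countable _)]

lemma survive_eq_lintegral [Countable Y] [MeasurableSingletonClass Y] [Countable A]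
    [MeasurableSingletonClass A] (p : Kernel ((Y ⊕ Unit) × A) (Y ⊕ Unit))
    (π : Strategy (Y ⊕ Unit) A) (x0 : Y ⊕ Unit) (t : ℕ) :
    survive p π x0 t =
      ∫⁻ h, (Set.range Sum.inl).indicator 1 h.2 ∂(histLaw p π x0 t) := by
  have := π.2 t
  have hs : MeasurableSet {z : (Y ⊕ Unit) × A | ∃ y : Y, z.1 = Sum.inl y} :=
    (Set.to_countable _).measurableSet
  rw [survive, pairLaw, Measure.bind_apply hs (measurable_of_countable _).aemeasurable]
  congr with h
  rw [Measure.map_apply (measurable_of_countable _) hs]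
  by_cases hh : h.2 ∈ Set.range (Sum.inl : Y → Y ⊕ Unit)
  · have : (fun a : A => (h.2, a)) ⁻¹' {z | ∃ y : Y, z.1 = Sum.inl y} = Set.univ := by
      obtain ⟨y, hy⟩ := hh
      exact Set.eq_univ_of_forall fun a => ⟨y, hy.symm⟩
    simp [this, hh]
  · have : (fun a : A => (h.2, a)) ⁻¹' {z | ∃ y : Y, z.1 = Sum.inl y} = ∅ := by
      refine Set.eq_empty_of_forall_notMem fun a ⟨y, hy⟩ => hh ⟨y, hy.symm⟩
    simp [this, hh]

/-- A Lyapunov function bounds the expected absorption time under every strategy. -/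
lemma tsum_survive_le [Countable Y] [MeasurableSingletonClass Y] [Countable A]
    [MeasurableSingletonClass A] (p : Kernel ((Y ⊕ Unit) × A) (Y ⊕ Unit))
    (V : Y ⊕ Unit → ℝ≥0∞)
    (hV : ∀ x a, (Set.range Sum.inl).indicator 1 x + ∫⁻ y, V y ∂(p (x, a)) ≤ V x)
    (π : Strategy (Y ⊕ Unit) A) (x0 : Y ⊕ Unit) :
    ∑' t, survive p π x0 t ≤ V x0 := by
  have key : ∀ n, ∑ t ∈ Finset.range n, survive p π x0 t +
      ∫⁻ h, V h.2 ∂(histLaw p π x0 n) ≤ V x0 := by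
    intro n
    induction n with
    | zero => simp [histLaw, lintegral_dirac' _ (measurable_of_countable _)]
    | succ n ih =>
      refine le_trans ?_ ih
      rw [Finset.sum_range_succ, add_assoc]
      gcongr
      rw [survive_eq_lintegral, lintegral_histLaw_succ,
        ← lintegral_add_left (measurable_of_countable _)]
      refine lintegral_mono fun h => ?_
      have := π.2 n
      calc (Set.range Sum.inl).indicator 1 h.2 + ∫⁻ a, ∫⁻ x, V x ∂(p (h.2, a)) ∂(π.1 n h)
          = ∫⁻ a, ((Set.range Sum.inl).indicator 1 h.2 + ∫⁻ x, V x ∂(p (h.2, a)))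
              ∂(π.1 n h) := by
            rw [lintegral_add_left measurable_const]
            simp
        _ ≤ ∫⁻ _, V h.2 ∂(π.1 n h) := lintegral_mono fun a => hV h.2 a
        _ = V h.2 := by simp
  rw [ENNReal.tsum_eq_iSup_nat]
  exact iSup_le fun n => le_self_add.trans (key n)

lemma lintegral_eq_sum_of_sum_singleton_eq_one [MeasurableSingletonClass X] {μ : Measure X}
    [IsProbabilityMeasure μ] (s : Finset X) (hs : ∑ x ∈ s, μ {x} = 1) (f : X → ℝ≥0∞) :
    ∫⁻ x, f x ∂μ = ∑ x ∈ s, f x * μ {x} := by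
  rw [← lintegral_finset, Measure.restrict_eq_self_of_ae_mem]
  rw [sum_measure_singleton] at hs
  exact (prob_compl_eq_zero_iff s.measurableSet).2 hs

lemma bY_injective : Function.Injective bY := by
  intro i j h
  have h' : b2 (i + 1) = b2 (j + 1) := congrArg Subtype.val h
  have h2 : ((1 : ℝ) / 2) ^ (i + 1) = (1 / 2) ^ (j + 1) := by
    simpa [b2] using h'
  have := pow_right_injective₀ (by norm_num : (0 : ℝ) < 1 / 2) (by norm_num) h2
  omega

lemma bY_ne_oneY (k : ℕ) : bY k ≠ oneY := by
  intro h
  have h' : b2 (k + 1) = 1 := congrArg Subtype.val h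
  have : (0 : ℝ) < (1 / 2) ^ (k + 1) := by positivity
  simp only [b2] at h'
  linarith

lemma eq_bY_or_eq_oneY (y : Y2) : (∃ k, y = bY k) ∨ y = oneY := by
  obtain ⟨y, ⟨k, hk⟩ | hy⟩ := y
  · exact Or.inl ⟨k, Subtype.ext hk⟩
  · exact Or.inr (Subtype.ext hy)

open scoped Classical in
/-- A Lyapunov function of the model E2. -/
def lyapunov2 : X2 → ℝ≥0∞
  | Sum.inr _ => 0
  | Sum.inl y => if h : ∃ k, y = bY k then 3 + 2 ^ h.choose else 1

lemma lyapunov2_bY (k : ℕ) : lyapunov2 (Sum.inl (bY k)) = 3 + 2 ^ k := by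
  have h : ∃ j, bY k = bY j := ⟨k, rfl⟩
  have hk : h.choose = k := (bY_injective h.choose_spec).symm
  rw [lyapunov2, dif_pos h, hk]

lemma lyapunov2_oneY : lyapunov2 (Sum.inl oneY) = 1 := by
  rw [lyapunov2, dif_neg]
  rintro ⟨k, hk⟩
  exact bY_ne_oneY k hk.symm

lemma lintegral_lyapunov2_of_apply_cemetery_eq_one {μ : Measure X2} [IsProbabilityMeasure μ]
    (h : μ {Sum.inr ()} = 1) : ∫⁻ y, lyapunov2 y ∂μ = 0 := by
  rw [lintegral_eq_sum_of_sum_singleton_eq_one {Sum.inr ()} (by simpa using h)]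
  simp [lyapunov2]

lemma lyapunov2_drift {p : Kernel (X2 × A2) X2} [IsMarkovKernel p] (hp : IsE2Kernel p)
    (x : X2) (a : A2) :
    (Set.range Sum.inl).indicator 1 x + ∫⁻ y, lyapunov2 y ∂(p (x, a)) ≤ lyapunov2 x := by
  classical
  obtain ⟨hcem, hone, hstart, hstay, hmove, hbranch⟩ := hp
  obtain y | u := x
  swap
  · rw [lintegral_lyapunov2_of_apply_cemetery_eq_one (hcem a)]
    simp
  rw [Set.indicator_of_mem (Set.mem_range_self y), Pi.one_apply]
  obtain ⟨k, rfl⟩ | rfl := eq_bY_or_eq_oneY y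
  swap
  · rw [lintegral_lyapunov2_of_apply_cemetery_eq_one (hone a), lyapunov2_oneY]
    simp
  fin_cases a
  · obtain rfl | hk := Nat.eq_zero_or_pos k
    · simp only [Fin.zero_eta, Fin.isValue]
      rw [lintegral_lyapunov2_of_apply_cemetery_eq_one hstart, lyapunov2_bY]
      norm_num
    · obtain ⟨j, rfl⟩ : ∃ j, k = j + 1 := ⟨k - 1, by omega⟩
      obtain ⟨h1, h2⟩ := hstay (j + 1) hk
      have hle : (1 / 2 : ℝ≥0∞) ^ j ≤ 1 := pow_le_one₀ zero_le (by norm_num)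
      simp only [Nat.add_sub_cancel] at h1 h2
      simp only [Fin.zero_eta, Fin.isValue]
      rw [lintegral_eq_sum_of_sum_singleton_eq_one {Sum.inl (bY (j + 1)), Sum.inr ()}
        (by rw [Finset.sum_pair (by simp), h1, h2, tsub_add_cancel_of_le hle]),
        Finset.sum_pair (by simp), h1, h2, lyapunov2_bY]
      have hV : (1 : ℝ≥0∞) ≤ (3 + 2 ^ (j + 1)) * (1 / 2) ^ j := by
        calc (1 : ℝ≥0∞) = 2 ^ j * (1 / 2) ^ j := by
              rw [← mul_pow, one_div, ENNReal.mul_inv_cancel (by simp) (by simp), one_pow]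
          _ ≤ (3 + 2 ^ (j + 1)) * (1 / 2) ^ j := by
              gcongr
              rw [pow_succ, mul_two]
              exact le_add_left le_self_add
      calc 1 + ((3 + 2 ^ (j + 1)) * (1 - (1 / 2 : ℝ≥0∞) ^ j) +
              lyapunov2 (Sum.inr ()) * (1 / 2) ^ j)
          ≤ (3 + 2 ^ (j + 1)) * (1 / 2) ^ j + (3 + 2 ^ (j + 1)) * (1 - (1 / 2 : ℝ≥0∞) ^ j) := by
            simp only [lyapunov2, zero_mul, add_zero]
            gcongr
        _ = 3 + 2 ^ (j + 1) := by
            rw [← mul_add, add_tsub_cancel_of_le hle, mul_one]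
  · obtain ⟨h1, h2⟩ := hmove k
    simp only [Fin.mk_one, Fin.isValue]
    rw [lintegral_eq_sum_of_sum_singleton_eq_one {Sum.inl (bY (k + 1)), Sum.inr ()}
      (by rw [Finset.sum_pair (by simp), h1, h2, ENNReal.add_halves]),
      Finset.sum_pair (by simp), h1, h2, lyapunov2_bY, lyapunov2_bY]
    have hpow : (2 : ℝ≥0∞) ^ (k + 1) * (1 / 2) = 2 ^ k := by
      rw [pow_succ, mul_assoc, one_div, ENNReal.mul_inv_cancel (by simp) (by simp), mul_one]
    have hc : (1 : ℝ≥0∞) + 3 * (1 / 2) ≤ 3 := by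
      rw [← ENNReal.toReal_le_toReal (by finiteness) (by finiteness),
        ENNReal.toReal_add (by finiteness) (by finiteness)]
      simp
      norm_num
    simp only [lyapunov2, zero_mul, add_zero]
    rw [add_mul, hpow, ← add_assoc]
    gcongr
  · obtain ⟨h1, h2, h3⟩ := hbranch k
    have hnm : (Sum.inl (bY (k + 1)) : X2) ∉ ({Sum.inl oneY, Sum.inr ()} : Finset X2) := by
      simpa using bY_ne_oneY (k + 1)
    have hquarter : (1 / 2 : ℝ≥0∞) + (1 / 4 + 1 / 4) = 1 := by
      rw [← ENNReal.toReal_eq_toReal_iff' (by finiteness) (by finiteness),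
        ENNReal.toReal_add (by finiteness) (by finiteness),
        ENNReal.toReal_add (by finiteness) (by finiteness)]
      simp
      norm_num
    simp only [Fin.reduceFinMk, Fin.isValue]
    rw [lintegral_eq_sum_of_sum_singleton_eq_one {Sum.inl (bY (k + 1)), Sum.inl oneY, Sum.inr ()}
      (by rw [Finset.sum_insert hnm, Finset.sum_pair (by simp), h1, h2, h3, hquarter]),
      Finset.sum_insert hnm, Finset.sum_pair (by simp), h1, h2, h3, lyapunov2_bY, lyapunov2_bY,
      lyapunov2_oneY]
    have hpow : (2 : ℝ≥0∞) ^ (k + 1) * (1 / 2) = 2 ^ k := by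
      rw [pow_succ, mul_assoc, one_div, ENNReal.mul_inv_cancel (by simp) (by simp), mul_one]
    have hc : (1 : ℝ≥0∞) + 3 * (1 / 2) + 1 * (1 / 4) ≤ 3 := by
      rw [← ENNReal.toReal_le_toReal (by finiteness) (by finiteness),
        ENNReal.toReal_add (by finiteness) (by finiteness),
        ENNReal.toReal_add (by finiteness) (by finiteness)]
      simp
      norm_num
    simp only [lyapunov2, zero_mul, add_zero]
    calc (1 : ℝ≥0∞) + ((3 + 2 ^ (k + 1)) * (1 / 2) + 1 * (1 / 4))
        = (1 + 3 * (1 / 2) + 1 * (1 / 4)) + 2 ^ (k + 1) * (1 / 2) := by ring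
      _ ≤ 3 + 2 ^ k := by
          rw [hpow]
          gcongr

/-- Under a deterministic stationary strategy the state follows a Markov chain. -/
lemma histLaw_succ_ge [Countable X] [MeasurableSingletonClass X] [Countable A]
    [MeasurableSingletonClass A] {p : Kernel (X × A) X} {π : Strategy X A} {ψ : X → A}
    (hπ : IsStationaryWith π ψ) (x0 : X) (n : ℕ) (x y : X) :
    histLaw p π x0 n {h | h.2 = x} * p (x, ψ x) {y} ≤ histLaw p π x0 (n + 1) {h | h.2 = y} := by
  have hm : ∀ (m : ℕ) (z : X), MeasurableSet {h : Hist X A m | h.2 = z} := fun m z =>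
    (Set.to_countable _).measurableSet
  have hy : histLaw p π x0 (n + 1) {h | h.2 = y} =
      ∫⁻ h, ({y} : Set X).indicator 1 h.2 ∂(histLaw p π x0 (n + 1)) := by
    rw [← lintegral_indicator_one (hm _ _)]
    rfl
  rw [hy, lintegral_histLaw_succ, mul_comm, ← lintegral_indicator_const (hm _ _)]
  refine lintegral_mono fun h => Set.indicator_apply_le' (fun hx => ?_) fun _ => zero_le
  rw [hπ n h, lintegral_dirac]
  rw [Set.mem_ofPred_eq] at hx
  rw [hx, lintegral_indicator_one (measurableSet_singleton y)]

lemma histLaw_le_survive [Countable Y] [MeasurableSingletonClass Y] [Countable A]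
    [MeasurableSingletonClass A] (p : Kernel ((Y ⊕ Unit) × A) (Y ⊕ Unit))
    (π : Strategy (Y ⊕ Unit) A) (x0 : Y ⊕ Unit) (t : ℕ) (y : Y) :
    histLaw p π x0 t {h | h.2 = Sum.inl y} ≤ survive p π x0 t := by
  rw [survive_eq_lintegral, ← lintegral_indicator_one (Set.to_countable _).measurableSet]
  refine lintegral_mono fun h => Set.indicator_apply_le' (fun hh => ?_) fun _ => zero_le
  rw [Set.mem_ofPred_eq] at hh
  rw [Set.indicator_of_mem (s := Set.range Sum.inl) ⟨y, hh.symm⟩]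
  rfl

lemma psiN_bY_of_lt {k n : ℕ} (h : k < n) : psiN n (Sum.inl (bY k)) = 1 := by
  have h1 : ((bY k : Y2) : ℝ) ≠ 1 := fun h1 => bY_ne_oneY k (Subtype.ext h1)
  simp only [psiN, if_neg h1]
  exact if_pos ⟨k, h, rfl⟩

lemma psiN_bY_self (n : ℕ) : psiN n (Sum.inl (bY n)) = 0 := by
  have h1 : ((bY n : Y2) : ℝ) ≠ 1 := fun h1 => bY_ne_oneY n (Subtype.ext h1)
  simp only [psiN, if_neg h1]
  refine if_neg ?_
  rintro ⟨k, hk, hb⟩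
  exact hk.ne (bY_injective (Subtype.ext hb)).symm

lemma half_le_tsum_survive {p : Kernel (X2 × A2) X2} (hp : IsE2Kernel p) {n : ℕ} (hn : 1 ≤ n)
    {π : Strategy X2 A2} (hπ : IsStationaryWith π (psiN n)) :
    (1/2 : ℝ≥0∞) ≤ ∑' t : ℕ, survive p π x02 (n + t) := by
  obtain ⟨-, -, -, hstay, hmove, -⟩ := hp
  have climb : ∀ k ≤ n, (1/2 : ℝ≥0∞) ^ k ≤
      histLaw p π x02 k {h | h.2 = Sum.inl (bY k)} := by
    intro k
    induction k with
    | zero =>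
      intro _
      simp [histLaw, x02]
    | succ k ih =>
      intro hk
      refine le_trans ?_ (histLaw_succ_ge hπ x02 k (Sum.inl (bY k)) _)
      rw [psiN_bY_of_lt (by omega), (hmove k).2, pow_succ]
      gcongr
      exact ih (by omega)
  have wait : ∀ t, (1/2 : ℝ≥0∞) ^ n * (1 - (1/2) ^ (n - 1)) ^ t ≤
      histLaw p π x02 (n + t) {h | h.2 = Sum.inl (bY n)} := by
    intro t
    induction t with
    | zero => simpa using climb n le_rfl
    | succ t ih =>
      refine le_trans ?_ (histLaw_succ_ge hπ x02 (n + t) (Sum.inl (bY n)) _)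
      rw [psiN_bY_self, (hstay n hn).1, pow_succ, ← mul_assoc]
      gcongr
  refine le_trans (le_of_eq ?_)
    (ENNReal.tsum_le_tsum fun t => (wait t).trans (histLaw_le_survive p π x02 (n + t) (bY n)))
  obtain ⟨m, rfl⟩ : ∃ m, n = m + 1 := ⟨n - 1, by omega⟩
  have hle : (1 / 2 : ℝ≥0∞) ^ m ≤ 1 := pow_le_one₀ zero_le (by norm_num)
  rw [ENNReal.tsum_mul_left, ENNReal.tsum_geometric, Nat.add_sub_cancel,
    ENNReal.sub_sub_cancel (by simp) hle, pow_succ, mul_right_comm,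
    ENNReal.mul_inv_cancel (by simp) (by finiteness), one_mul]

/-- The deterministic stationary strategy given by a map on a countable discrete state space. -/
def stationaryStrategy [Countable X] [MeasurableSingletonClass X] [Countable A]
    [MeasurableSingletonClass A] (ψ : X → A) : Strategy X A :=
  ⟨fun _ => Kernel.deterministic (fun h => ψ h.2) ((measurable_of_countable ψ).comp measurable_snd),
    fun _ => inferInstance⟩

lemma isStationaryWith_stationaryStrategy [Countable X] [MeasurableSingletonClass X]
    [Countable A] [MeasurableSingletonClass A] (ψ : X → A) :
    IsStationaryWith (stationaryStrategy ψ) ψ :=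
  fun _ _ => Kernel.deterministic_apply ((measurable_of_countable ψ).comp measurable_snd) _

/-- The model E2 is absorbing with the initial state `x₀ = b_1 = 1/2`
(indeed `sup_π E^π_{1/2}[τ] < ∞`), but it is not `Λ`-uniformly absorbing: for each `n ≥ 3`,
`E^{ψ^n}_{1/2}[Σ_{t=n}^∞ 1{τ > t}] ≥ 1/2`, so `sup_{π ∈ Λ} E^π_{1/2}[Σ_{t=n}^∞ 1{τ > t}]`
does not converge to `0`. -/
theorem stmt12
    (p : Kernel (X2 × A2) X2) [IsMarkovKernel p] (hp : IsE2Kernel p) :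
    IsAbsorbing p x02 ∧
      (⨆ π : Strategy X2 A2, ∑' t : ℕ, survive p π x02 t) < ⊤ ∧
      (∀ n : ℕ, 3 ≤ n → ∀ π : Strategy X2 A2, IsStationaryWith π (psiN n) →
        (1/2 : ℝ≥0∞) ≤ ∑' t : ℕ, survive p π x02 (n + t)) ∧
      ¬ IsUnifAbsorbing p Lambda2 x02 := by
  have hbound : ∀ π : Strategy X2 A2, ∑' t : ℕ, survive p π x02 t ≤ 4 := fun π => by
    refine (tsum_survive_le p lyapunov2 (lyapunov2_drift hp) π x02).trans_eq ?_
    rw [x02, lyapunov2_bY]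
    norm_num
  refine ⟨fun π => (hbound π).trans_lt (by simp), (iSup_le hbound).trans_lt (by simp),
    fun n hn π hπ => half_le_tsum_survive hp (by omega) hπ, fun h => ?_⟩
  have hhalf : (1/2 : ℝ≥0∞) ≤ 0 := by
    refine ge_of_tendsto h ?_
    filter_upwards [eventually_ge_atTop 3] with n hn
    have hπ := isStationaryWith_stationaryStrategy (psiN n)
    exact (half_le_tsum_survive hp (by omega) hπ).trans
      (le_iSup₂_of_le (stationaryStrategy (psiN n)) (Or.inl ⟨n, hn, hπ⟩) le_rfl)
  simp at hhalf

end
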